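/- A finite binary word α is strongly fixed by b if and only if 1^{3n+2}·0 is a prefix of α for some natural number n; α is strongly fixed by c if and only if 1^{3n+1}·0 is a prefix of α for some n; and α is strongly fixed by d if and only if 1^{3n}·0 is a prefix of α for some n. -/

import Mathlib

/-- Generator `a` of the Grigorchuk group acting on finite binary words. -/
def grigA : List Bool → List Bool
  | [] => []
  | x :: w => (!x) :: w

mutual
  /-- Generator `b` of the Grigorchuk group acting on finite binary words. -/
  def grigB : List Bool → List Bool
    | [] => []
    | false :: w => false :: grigA w
    | true :: w => true :: grigC w
  /-- Generator `c` of the Grigorchuk group acting on finite binary words. -/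
  def grigC : List Bool → List Bool
    | [] => []
    | false :: w => false :: grigA w
    | true :: w => true :: grigD w
  /-- Generator `d` of the Grigorchuk group acting on finite binary words. -/
  def grigD : List Bool → List Bool
    | [] => []
    | false :: w => false :: w
    | true :: w => true :: grigB w
end

theorem grigA_ne_self (x : Bool) (w : List Bool) : grigA (x :: w) ≠ x :: w := by
  cases x <;> simp [grigA]

theorem exists_grigA_append_ne (α : List Bool) : ¬ ∀ w : List Bool, grigA (α ++ w) = α ++ w := by
  intro h
  cases α with
  | nil => exact grigA_ne_self false [] (h [false])
  | cons x α => exact grigA_ne_self x α (by simpa using h [])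

theorem replicate_true_append_false_prefix_false_cons (k : ℕ) (α : List Bool) :
    List.replicate k true ++ [false] <+: false :: α ↔ k = 0 := by
  cases k <;> simp [List.replicate_succ]

theorem replicate_true_append_false_prefix_true_cons (k : ℕ) (α : List Bool) :
    List.replicate k true ++ [false] <+: true :: α ↔
      ∃ j, k = j + 1 ∧ List.replicate j true ++ [false] <+: α := by
  cases k <;> simp [List.replicate_succ]

/-- A finite binary word `α` is strongly fixed by `b` iff `1^{3n+2}·0` is a
prefix of `α` for some `n`; strongly fixed by `c` iff `1^{3n+1}·0` is a
prefix of `α` for some `n`; and strongly fixed by `d` iff `1^{3n}·0` is a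
prefix of `α` for some `n`. -/
theorem grig_strongly_fixed_iff_prefix (α : List Bool) :
    ((∀ w : List Bool, grigB (α ++ w) = α ++ w) ↔
      ∃ n : ℕ, (List.replicate (3 * n + 2) true ++ [false]) <+: α) ∧
    ((∀ w : List Bool, grigC (α ++ w) = α ++ w) ↔
      ∃ n : ℕ, (List.replicate (3 * n + 1) true ++ [false]) <+: α) ∧
    ((∀ w : List Bool, grigD (α ++ w) = α ++ w) ↔
      ∃ n : ℕ, (List.replicate (3 * n) true ++ [false]) <+: α) := by
  induction α with
  | nil =>
    refine ⟨iff_of_false (fun h => ?_) (by simp), iff_of_false (fun h => ?_) (by simp),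
      iff_of_false (fun h => ?_) (by simp)⟩
    · simpa [grigB, grigA] using h [false, false]
    · simpa [grigC, grigA] using h [false, false]
    · simpa [grigD, grigB, grigA] using h [true, false, false]
  | cons x α ih =>
    obtain ⟨hb, hc, hd⟩ := ih
    cases x
    · simp only [replicate_true_append_false_prefix_false_cons, List.cons_append, grigB, grigC,
        grigD, List.cons.injEq, true_and, exists_grigA_append_ne, implies_true, false_iff, true_iff]
      exact ⟨by simp, by simp, 0, rfl⟩
    · simp only [replicate_true_append_false_prefix_true_cons, List.cons_append, grigB, grigC,
        grigD, List.cons.injEq, true_and, hb, hc, hd]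
      refine ⟨⟨?_, ?_⟩, ⟨?_, ?_⟩, ⟨?_, ?_⟩⟩
      · rintro ⟨n, h⟩
        exact ⟨n, _, rfl, h⟩
      · rintro ⟨n, j, hj, h⟩
        obtain rfl : j = 3 * n + 1 := by omega
        exact ⟨n, h⟩
      · rintro ⟨n, h⟩
        exact ⟨n, _, rfl, h⟩
      · rintro ⟨n, j, hj, h⟩
        obtain rfl : j = 3 * n := by omega
        exact ⟨n, h⟩
      · rintro ⟨n, h⟩
        exact ⟨n + 1, _, rfl, h⟩
      · rintro ⟨n, j, hj, h⟩
        obtain ⟨m, rfl⟩ : ∃ m, j = 3 * m + 2 := ⟨n - 1, by omega⟩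
        exact ⟨m, h⟩
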